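/- arXiv:2210.09183 — 4 statements merged into one kernel-verified Lean document; each statement's English description precedes it below -/
import Mathlib

section
/- Let $p \in (1, \infty)$ and $d \ge 1$. There exists a constant $C_1 > 0$, depending only on $p$, such that for all $\xi, \eta \in \mathbb{R}^d$: $\big\| \; \|\xi\|^{p-2}\xi - \|\eta\|^{p-2}\eta \; \big\| \le C_1 \, \|\xi - \eta\| \, (\|\xi\| + \|\eta\|)^{p-2}$, where $\|\cdot\|$ is the Euclidean norm. -/
lemma one_sub_rpow_le {r s : ℝ} (hr : 0 < r) (hs : 0 ≤ s) (hs1 : s ≤ 1) :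
    1 - s ^ r ≤ (1 + r) * (1 - s) := by
  rcases le_total r 1 with h | h
  · have := Real.rpow_le_rpow_of_exponent_ge_of_imp hs hs1 h (fun _ h' => absurd h' one_ne_zero)
    rw [Real.rpow_one] at this
    nlinarith
  · have := one_add_mul_self_le_rpow_one_add (s := s - 1) (by linarith) h
    rw [add_sub_cancel] at this
    nlinarith

lemma abs_rpow_sub_rpow_mul_le {p a b : ℝ} (hp : 1 < p) (ha : 0 < a) (hb : 0 ≤ b)
    (hba : b ≤ a) :
    |a ^ (p - 2) - b ^ (p - 2)| * b ≤ (1 + p) * a ^ (p - 2) * (a - b) := by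
  obtain ⟨s, rfl⟩ : ∃ s, b = s * a := ⟨b / a, by field_simp⟩
  have hs : 0 ≤ s := nonneg_of_mul_nonneg_left hb ha
  have hs1 : s ≤ 1 := by nlinarith
  have hpow : s ^ (p - 1) = s ^ (p - 2) * s := by
    rw [← Real.rpow_add_one' hs (by linarith)]
    ring_nf
  have hle := one_sub_rpow_le (r := p - 1) (by linarith) hs hs1
  have hle1 : s ^ (p - 1) ≤ 1 := Real.rpow_le_one hs hs1 (by linarith)
  have key : |1 - s ^ (p - 2)| * s ≤ (1 + p) * (1 - s) := by
    rw [← abs_of_nonneg hs, ← abs_mul, abs_of_nonneg hs, abs_le, sub_mul, ← hpow]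
    constructor <;> nlinarith
  have hA : 0 < a ^ (p - 2) := Real.rpow_pos_of_pos ha _
  calc |a ^ (p - 2) - (s * a) ^ (p - 2)| * (s * a)
      = a ^ (p - 2) * a * (|1 - s ^ (p - 2)| * s) := by
        rw [Real.mul_rpow hs ha.le, ← one_sub_mul, abs_mul, abs_of_pos hA]
        ring
    _ ≤ a ^ (p - 2) * a * ((1 + p) * (1 - s)) := by gcongr
    _ = (1 + p) * a ^ (p - 2) * (a - s * a) := by ring

lemma rpow_le_two_rpow_abs_mul_add_rpow {a b : ℝ} (q : ℝ) (ha : 0 < a) (hb : 0 ≤ b)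
    (hba : b ≤ a) : a ^ q ≤ 2 ^ |q| * (a + b) ^ q := by
  rcases le_total 0 q with hq | hq
  · calc a ^ q ≤ (a + b) ^ q := Real.rpow_le_rpow ha.le (by linarith) hq
      _ ≤ 2 ^ |q| * (a + b) ^ q :=
        le_mul_of_one_le_left (by positivity)
          (Real.one_le_rpow one_le_two (abs_nonneg q))
  · calc a ^ q = 2 ^ |q| * (2 * a) ^ q := by
          rw [Real.mul_rpow zero_le_two ha.le, ← mul_assoc, ← Real.rpow_add two_pos,
            abs_of_nonpos hq, neg_add_cancel, Real.rpow_zero, one_mul]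
      _ ≤ 2 ^ |q| * (a + b) ^ q := by
          gcongr ?_ * ?_
          exact Real.rpow_le_rpow_of_nonpos (by linarith) (by linarith) hq

lemma norm_rpow_smul_sub_le_of_norm_le {E : Type*} [NormedAddCommGroup E] [NormedSpace ℝ E]
    {p : ℝ} (hp : 1 < p) {x y : E} (h : ‖y‖ ≤ ‖x‖) :
    ‖‖x‖ ^ (p - 2) • x - ‖y‖ ^ (p - 2) • y‖ ≤
      (2 + p) * 2 ^ |p - 2| * ‖x - y‖ * (‖x‖ + ‖y‖) ^ (p - 2) := by
  rcases eq_or_ne x 0 with rfl | hx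
  · obtain rfl : y = 0 := by simpa using h
    simp
  have ha : 0 < ‖x‖ := norm_pos_iff.mpr hx
  calc ‖‖x‖ ^ (p - 2) • x - ‖y‖ ^ (p - 2) • y‖
      = ‖‖x‖ ^ (p - 2) • (x - y) + (‖x‖ ^ (p - 2) - ‖y‖ ^ (p - 2)) • y‖ := by
        congr 1
        module
    _ ≤ ‖x‖ ^ (p - 2) * ‖x - y‖ + |‖x‖ ^ (p - 2) - ‖y‖ ^ (p - 2)| * ‖y‖ := by
        refine (norm_add_le _ _).trans_eq ?_
        rw [norm_smul, norm_smul, Real.norm_eq_abs, Real.norm_eq_abs,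
          abs_of_nonneg (Real.rpow_nonneg ha.le _)]
    _ ≤ ‖x‖ ^ (p - 2) * ‖x - y‖ + (1 + p) * ‖x‖ ^ (p - 2) * ‖x - y‖ := by
        refine add_le_add_right ?_ _
        refine (abs_rpow_sub_rpow_mul_le hp ha (norm_nonneg y) h).trans ?_
        gcongr
        exact norm_sub_norm_le x y
    _ = (2 + p) * ‖x - y‖ * ‖x‖ ^ (p - 2) := by ring
    _ ≤ (2 + p) * ‖x - y‖ * (2 ^ |p - 2| * (‖x‖ + ‖y‖) ^ (p - 2)) := by
        gcongr
        exact rpow_le_two_rpow_abs_mul_add_rpow _ ha (norm_nonneg y) h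
    _ = (2 + p) * 2 ^ |p - 2| * ‖x - y‖ * (‖x‖ + ‖y‖) ^ (p - 2) := by ring

/-- Barrett–Liu upper vector inequality (3.2a) for the p-Laplacian. -/
theorem barrett_liu_upper (p : ℝ) (hp : 1 < p) :
    ∃ C₁ : ℝ, 0 < C₁ ∧
      ∀ (d : ℕ), 1 ≤ d →
        ∀ ξ η : EuclideanSpace ℝ (Fin d),
          ‖(‖ξ‖ ^ (p - 2)) • ξ - (‖η‖ ^ (p - 2)) • η‖ ≤
            C₁ * ‖ξ - η‖ * (‖ξ‖ + ‖η‖) ^ (p - 2) := by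
  refine ⟨(2 + p) * 2 ^ |p - 2|, by positivity, fun d _ ξ η => ?_⟩
  rcases le_total ‖η‖ ‖ξ‖ with h | h
  · exact norm_rpow_smul_sub_le_of_norm_le hp h
  · rw [norm_sub_rev, norm_sub_rev ξ η, add_comm ‖ξ‖]
    exact norm_rpow_smul_sub_le_of_norm_le hp h
end

section
/- Let $p \in (1, \infty)$. For all real numbers $a, b \ge 0$ and all $t \in [0,1]$: $t^{\max\{p,2\}}\,(a+b)^{p-2}\,a^2 \le (t a + b)^{p-2}\,(t a)^2 \le t^{\min\{p,2\}}\,(a+b)^{p-2}\,a^2$. -/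
/-- Pointwise scaling inequality, the core of Lemma 3.1. -/
theorem pointwise_scaling (p : ℝ) (hp : 1 < p)
    (a b t : ℝ) (ha : 0 ≤ a) (hb : 0 ≤ b) (ht : t ∈ Set.Icc (0 : ℝ) 1) :
    t ^ max p 2 * (a + b) ^ (p - 2) * a ^ 2 ≤ (t * a + b) ^ (p - 2) * (t * a) ^ 2 ∧
      (t * a + b) ^ (p - 2) * (t * a) ^ 2 ≤ t ^ min p 2 * (a + b) ^ (p - 2) * a ^ 2 := by
  obtain ⟨ht0, ht1⟩ := ht
  rcases ha.eq_or_lt with rfl | ha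
  · simp
  rcases ht0.eq_or_lt with rfl | ht0
  · have hmax : max p 2 ≠ 0 := (zero_lt_two.trans_le (le_max_right p 2)).ne'
    have hmin : min p 2 ≠ 0 := (lt_min (zero_lt_one.trans hp) zero_lt_two).ne'
    simp [Real.zero_rpow hmax, Real.zero_rpow hmin]
  have hlow : t * (a + b) ≤ t * a + b := by nlinarith
  have hupp : t * a + b ≤ a + b := by nlinarith
  have hpos : 0 < t * (a + b) := by positivity
  have hmid : 0 < t * a + b := by positivity
  have hp_rpow : t ^ p * (a + b) ^ (p - 2) * a ^ 2 =
      (t * (a + b)) ^ (p - 2) * (t * a) ^ 2 := by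
    have h : t ^ p = t ^ (p - 2) * t ^ 2 := by
      rw [← Real.rpow_natCast t 2, ← Real.rpow_add ht0]
      norm_num
    rw [h, Real.mul_rpow ht0.le (by positivity)]
    ring
  have htwo_rpow : t ^ (2 : ℝ) * (a + b) ^ (p - 2) * a ^ 2 =
      (a + b) ^ (p - 2) * (t * a) ^ 2 := by
    rw [Real.rpow_two]
    ring
  rcases le_total 2 p with h | h
  · rw [max_eq_left h, min_eq_right h, hp_rpow, htwo_rpow]
    have hexp : 0 ≤ p - 2 := sub_nonneg.2 h
    constructor <;> gcongr
  · rw [max_eq_right h, min_eq_left h, hp_rpow, htwo_rpow]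
    have hexp : p - 2 ≤ 0 := sub_nonpos.2 h
    exact ⟨mul_le_mul_of_nonneg_right (Real.rpow_le_rpow_of_nonpos hmid hupp hexp) (sq_nonneg _),
      mul_le_mul_of_nonneg_right (Real.rpow_le_rpow_of_nonpos hpos hlow hexp) (sq_nonneg _)⟩
end

section
/- Let $p \in (1, \infty)$, let $(\Omega, \mu)$ be a measure space, let $g, h : \Omega \to \mathbb{R}^d$ be measurable, and define $\Phi_p(g, h) = \int_\Omega (\|g - h\| + \|h\|)^{p-2}\,\|g - h\|^2 \, d\mu \in [0, \infty]$. Then for every $t \in [0,1]$: $t^{\max\{p,2\}}\,\Phi_p(g, h) \le \Phi_p(h + t(g - h), h) \le t^{\min\{p,2\}}\,\Phi_p(g, h)$. -/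
open MeasureTheory

/-- The distance-like function Φ of the paper, for gradient fields, with values in [0,∞]. -/
noncomputable def PhiP {Ω : Type*} [MeasurableSpace Ω] (μ : Measure Ω) (p : ℝ) {d : ℕ}
    (g h : Ω → EuclideanSpace ℝ (Fin d)) : ENNReal :=
  ∫⁻ x, ENNReal.ofReal ((‖g x - h x‖ + ‖h x‖) ^ (p - 2) * ‖g x - h x‖ ^ 2) ∂μ

/-- Two-sided bound for the integrand of `PhiP` under scaling of the increment by `t ∈ [0, 1]`. -/
theorem rpow_add_mul_sq_scaling {p a b t : ℝ} (hp : 1 < p) (ha : 0 ≤ a) (hb : 0 ≤ b)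
    (ht₀ : 0 ≤ t) (ht₁ : t ≤ 1) :
    t ^ max p 2 * ((a + b) ^ (p - 2) * a ^ 2) ≤ (t * a + b) ^ (p - 2) * (t * a) ^ 2 ∧
      (t * a + b) ^ (p - 2) * (t * a) ^ 2 ≤ t ^ min p 2 * ((a + b) ^ (p - 2) * a ^ 2) := by
  have hmax : max p 2 ≠ 0 := (lt_max_of_lt_right two_pos).ne'
  have hmin : min p 2 ≠ 0 := (lt_min (by linarith) two_pos).ne'
  rcases ht₀.eq_or_lt with rfl | ht
  · simp [Real.zero_rpow hmax, Real.zero_rpow hmin]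
  rcases ha.eq_or_lt with rfl | ha'
  · simp
  have hab : 0 < a + b := by linarith
  have hs : 0 < t * a + b := by positivity
  have hlow : t * (a + b) ≤ t * a + b := by nlinarith
  have hupp : t * a + b ≤ a + b := by nlinarith
  have hpow : t ^ p = t ^ (p - 2) * t ^ 2 := by
    rw [← Real.rpow_natCast t 2, ← Real.rpow_add ht]
    norm_num
  have hsq : 0 ≤ (t * a) ^ 2 := sq_nonneg _
  have hsplit : t ^ p * ((a + b) ^ (p - 2) * a ^ 2) = (t * (a + b)) ^ (p - 2) * (t * a) ^ 2 := by
    rw [Real.mul_rpow ht₀ hab.le, hpow]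
    ring
  have htwo : t ^ (2 : ℝ) * ((a + b) ^ (p - 2) * a ^ 2) = (a + b) ^ (p - 2) * (t * a) ^ 2 := by
    rw [Real.rpow_two]
    ring
  rcases le_total 2 p with h | h
  · rw [max_eq_left h, min_eq_right h, hsplit, htwo]
    have hq : 0 ≤ p - 2 := by linarith
    exact ⟨mul_le_mul_of_nonneg_right (Real.rpow_le_rpow (by positivity) hlow hq) hsq,
      mul_le_mul_of_nonneg_right (Real.rpow_le_rpow hs.le hupp hq) hsq⟩
  · rw [max_eq_right h, min_eq_left h, hsplit, htwo]
    have hq : p - 2 ≤ 0 := by linarith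
    exact ⟨mul_le_mul_of_nonneg_right (Real.rpow_le_rpow_of_nonpos hs hupp hq) hsq,
      mul_le_mul_of_nonneg_right (Real.rpow_le_rpow_of_nonpos (by positivity) hlow hq) hsq⟩

/-- Scaling property of Φ (Lemma 3.1, stated for gradient fields). -/
theorem Phi_scaling {Ω : Type*} [MeasurableSpace Ω] (μ : Measure Ω)
    (p : ℝ) (hp : 1 < p) (d : ℕ)
    (g h : Ω → EuclideanSpace ℝ (Fin d))
    (hg : Measurable g) (hh : Measurable h)
    (t : ℝ) (ht : t ∈ Set.Icc (0 : ℝ) 1) :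
    ENNReal.ofReal (t ^ max p 2) * PhiP μ p g h ≤
        PhiP μ p (fun x => h x + t • (g x - h x)) h ∧
      PhiP μ p (fun x => h x + t • (g x - h x)) h ≤
        ENNReal.ofReal (t ^ min p 2) * PhiP μ p g h := by
  have key x := rpow_add_mul_sq_scaling hp (norm_nonneg (g x - h x)) (norm_nonneg (h x)) ht.1 ht.2
  simp only [PhiP, add_sub_cancel_left, norm_smul, Real.norm_of_nonneg ht.1]
  rw [← lintegral_const_mul' _ _ ENNReal.ofReal_ne_top,
    ← lintegral_const_mul' _ _ ENNReal.ofReal_ne_top]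
  simp only [← ENNReal.ofReal_mul (Real.rpow_nonneg ht.1 _)]
  exact ⟨lintegral_mono fun x => ENNReal.ofReal_le_ofReal (key x).1,
    lintegral_mono fun x => ENNReal.ofReal_le_ofReal (key x).2⟩
end

section
/- Let $p \in (1, \infty)$, let $(\Omega, \mu)$ be a measure space, let $g, h : \Omega \to \mathbb{R}^d$ be measurable, and define $\Phi_p(g, h) = \int_\Omega (\|g - h\| + \|h\|)^{p-2}\,\|g - h\|^2 \, d\mu \in [0, \infty]$. Then $\Phi_p(g, h) \le 2^{|p-2|}\,\Phi_p(h, g)$. -/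
open MeasureTheory

/-- Comparable positive reals have comparable real powers. -/
theorem Real.rpow_le_rpow_abs_mul_rpow {a b c : ℝ} (s : ℝ) (ha : 0 < a) (hb : 0 < b) (hc : 0 < c)
    (hab : a ≤ c * b) (hba : b ≤ c * a) : a ^ s ≤ c ^ |s| * b ^ s := by
  rcases le_total 0 s with hs | hs
  · rw [abs_of_nonneg hs, ← Real.mul_rpow hc.le hb.le]
    exact Real.rpow_le_rpow ha.le hab hs
  · have h := Real.rpow_le_rpow_of_nonpos hb hba hs
    rw [Real.mul_rpow hc.le ha.le] at h
    calc a ^ s = c ^ (-s) * (c ^ s * a ^ s) := by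
          rw [← mul_assoc, ← Real.rpow_add hc, neg_add_cancel, Real.rpow_zero, one_mul]
      _ ≤ c ^ |s| * b ^ s := by
          rw [abs_of_nonpos hs]
          gcongr

theorem norm_sub_add_norm_le_two_mul {E : Type*} [SeminormedAddCommGroup E] (u v : E) :
    ‖u - v‖ + ‖v‖ ≤ 2 * (‖v - u‖ + ‖u‖) := by
  have h := norm_le_norm_add_norm_sub' v u
  rw [norm_sub_rev u v]
  linarith [norm_nonneg u]

theorem norm_sub_add_norm_rpow_mul_sq_le {E : Type*} [SeminormedAddCommGroup E] (s : ℝ) (u v : E) :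
    (‖u - v‖ + ‖v‖) ^ s * ‖u - v‖ ^ 2 ≤
      2 ^ |s| * ((‖v - u‖ + ‖u‖) ^ s * ‖v - u‖ ^ 2) := by
  rcases (norm_nonneg (u - v)).eq_or_lt with h0 | h0
  · rw [norm_sub_rev v u, ← h0]
    simp
  · have h0' : 0 < ‖v - u‖ := norm_sub_rev u v ▸ h0
    rw [← mul_assoc, norm_sub_rev v u]
    gcongr
    rw [← norm_sub_rev v u]
    nth_rewrite 1 [norm_sub_rev v u]
    exact Real.rpow_le_rpow_abs_mul_rpow s (by positivity) (by positivity) two_pos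
      (norm_sub_add_norm_le_two_mul u v) (norm_sub_add_norm_le_two_mul v u)

/-- Quasi-symmetry of Φ (Lemma 3.2, stated for gradient fields). -/
theorem Phi_quasi_symmetry {Ω : Type*} [MeasurableSpace Ω] (μ : Measure Ω)
    (p : ℝ) (hp : 1 < p) (d : ℕ)
    (g h : Ω → EuclideanSpace ℝ (Fin d))
    (hg : Measurable g) (hh : Measurable h) :
    PhiP μ p g h ≤ ENNReal.ofReal ((2 : ℝ) ^ |p - 2|) * PhiP μ p h g := by
  unfold PhiP
  rw [← lintegral_const_mul' _ _ ENNReal.ofReal_ne_top]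
  refine lintegral_mono fun x => ?_
  rw [← ENNReal.ofReal_mul (by positivity)]
  exact ENNReal.ofReal_le_ofReal (norm_sub_add_norm_rpow_mul_sq_le (p - 2) (g x) (h x))
end
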